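/- arXiv:0903.2240 — 3 statements merged into one kernel-verified Lean document; each statement's English description precedes it below -/
import Mathlib

section
/- For commutative rings R₁, R₂ and modules Eᵢ over Rᵢ (i = 1,2), the projective dimension of E₁ × E₂ over R₁ × R₂ equals the supremum of the projective dimensions of E₁ over R₁ and of E₂ over R₂. -/
universe u v

/-- `pdLE R n M` means the projective dimension of `M` over `R` is at most `n`. -/
def pdLE (R : Type v) [Ring R] : ℕ → ∀ (M : Type u) [AddCommGroup M] [Module R M], Prop
  | 0 => fun M _ _ => Module.Projective R M
  | n + 1 => fun M _ _ =>
      ∃ (P : Type u) (_ : AddCommGroup P) (_ : Module R P) (f : P →ₗ[R] M),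
        Module.Projective R P ∧ Function.Surjective f ∧ pdLE R n (LinearMap.ker f)

/-- The projective dimension of `M` over `R`, as an element of `ℕ∞` (with `⊤` meaning
infinite projective dimension). -/
noncomputable def projDim (R : Type v) [Ring R] (M : Type u) [AddCommGroup M]
    [Module R M] : ℕ∞ :=
  sInf {n : ℕ∞ | ∃ m : ℕ, n = m ∧ pdLE R m M}

theorem pdLE_succ (R : Type v) [Ring R] (n : ℕ) : ∀ (M : Type u) [AddCommGroup M] [Module R M],
    pdLE R n M → pdLE R (n + 1) M := by
  induction n with
  | zero =>
    intro M _ _ h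
    refine ⟨M, inferInstance, inferInstance, LinearMap.id, h, Function.surjective_id, ?_⟩
    have : Subsingleton (LinearMap.ker (LinearMap.id : M →ₗ[R] M)) := by
      rw [LinearMap.ker_id]; infer_instance
    change Module.Projective R _
    infer_instance
  | succ n ih =>
    rintro M _ _ ⟨P, i1, i2, f, hP, hf, hk⟩
    exact ⟨P, i1, i2, f, hP, hf, ih _ hk⟩

theorem pdLE_mono (R : Type v) [Ring R] {n m : ℕ} (h : n ≤ m) (M : Type u) [AddCommGroup M]
    [Module R M] (hM : pdLE R n M) : pdLE R m M := by
  induction h with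
  | refl => exact hM
  | step _ ih => exact pdLE_succ R _ M ih

theorem projDim_le_iff (R : Type v) [Ring R] (n : ℕ) (M : Type u) [AddCommGroup M]
    [Module R M] : projDim R M ≤ n ↔ pdLE R n M := by
  constructor
  · intro h
    have hne : {n : ℕ∞ | ∃ m : ℕ, n = m ∧ pdLE R m M}.Nonempty := by
      by_contra hc
      rw [Set.not_nonempty_iff_eq_empty] at hc
      rw [projDim, hc, sInf_empty] at h
      exact absurd h (by simp)
    obtain ⟨m, hm, hp⟩ := csInf_mem hne
    rw [projDim, hm] at h
    exact pdLE_mono R (by exact_mod_cast h) M hp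
  · intro h
    exact sInf_le ⟨n, rfl, h⟩

/-- products, up to isomorphism -/
theorem pdLE_prod (R : Type v) [Ring R] (n : ℕ) : ∀ (A B C : Type u) [AddCommGroup A] [Module R A]
    [AddCommGroup B] [Module R B] [AddCommGroup C] [Module R C] (_ : (A × B) ≃ₗ[R] C),
    pdLE R n A → pdLE R n B → pdLE R n C := by
  induction n with
  | zero =>
    intro A B C _ _ _ _ _ _ e hA hB
    have hA : Module.Projective R A := hA
    have hB : Module.Projective R B := hB
    exact Module.Projective.of_equiv e
  | succ n ih =>
    rintro A B C _ _ _ _ _ _ e ⟨P, i1, i2, f, hP, hf, hk⟩ ⟨Q, j1, j2, g, hQ, hg, hl⟩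
    refine ⟨P × Q, inferInstance, inferInstance, e.toLinearMap ∘ₗ f.prodMap g, inferInstance,
      e.surjective.comp (Prod.map_surjective.2 ⟨hf, hg⟩), ?_⟩
    refine ih (LinearMap.ker f) (LinearMap.ker g) _ ?_ hk hl
    refine LinearEquiv.ofBijective
      (LinearMap.codRestrict _ ((LinearMap.ker f).subtype.prodMap (LinearMap.ker g).subtype) ?_)
      ⟨?_, ?_⟩
    · rintro ⟨⟨a, ha⟩, ⟨b, hb⟩⟩
      simp at ha hb
      simp [ha, hb]
    · rintro ⟨⟨a, ha⟩, ⟨b, hb⟩⟩ ⟨⟨a', ha'⟩, ⟨b', hb'⟩⟩ h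
      have := congrArg Subtype.val h
      simpa using this
    · rintro ⟨⟨a, b⟩, h⟩
      simp at h
      exact ⟨⟨⟨a, h.1⟩, ⟨b, h.2⟩⟩, rfl⟩

section
variable {R : Type*} {S : Type*} [CommRing R] [CommRing S] (σ : R →+* S) (τ : S →ₙ+* R)

/-- Restriction of scalars preserves projectives. -/
theorem proj_restrict (h1 : ∀ s, σ (τ s) = s) (h2 : ∀ r, τ (σ r) = τ 1 * r)
    {N N' : Type*} [AddCommGroup N] [Module S N] [AddCommGroup N'] [Module R N']
    (e : N ≃+ N') (he : ∀ r x, e (σ r • x) = r • e x) (hN : Module.Projective S N) :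
    Module.Projective R N' := by
  obtain ⟨s, hs⟩ := Module.projective_def'.1 hN
  have key : ∀ r s, τ (σ r * s) = r * τ s := by
    intro r s
    rw [map_mul, h2, mul_right_comm, ← map_mul, one_mul, mul_comm]
  let i : N' →ₗ[R] (N →₀ R) :=
    { toFun := fun x => (s (e.symm x)).mapRange τ (map_zero τ)
      map_add' := fun x y => by ext; simp
      map_smul' := fun r x => by
        have : e.symm (r • x) = σ r • e.symm x := by
          apply e.injective; rw [he]; simp
        ext n
        simp [this, key] }
  let p : (N →₀ R) →ₗ[R] N' := Finsupp.linearCombination R e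
  refine Module.Projective.of_split i p ?_
  ext x
  have h := LinearMap.congr_fun hs (e.symm x)
  simp only [LinearMap.comp_apply, LinearMap.id_apply] at h
  simp only [LinearMap.comp_apply, LinearMap.id_apply, p, i, LinearMap.coe_mk, AddHom.coe_mk]
  rw [Finsupp.linearCombination_apply, Finsupp.sum_mapRange_index (by simp)]
  conv_rhs => rw [← e.apply_symm_apply x, ← h]
  rw [Finsupp.linearCombination_apply, Finsupp.sum, Finsupp.sum, map_sum]
  refine Finset.sum_congr rfl fun n _ => ?_
  rw [← he, h1]; rfl

theorem pdLE_restrict (h1 : ∀ s, σ (τ s) = s) (h2 : ∀ r, τ (σ r) = τ 1 * r) (n : ℕ) :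
    ∀ (N N' : Type u) [AddCommGroup N] [Module S N] [AddCommGroup N'] [Module R N']
    (e : N ≃+ N') (_ : ∀ r x, e (σ r • x) = r • e x), pdLE S n N → pdLE R n N' := by
  induction n with
  | zero =>
    intro N N' _ _ _ _ e he h
    exact proj_restrict σ τ h1 h2 e he h
  | succ n ih =>
    rintro N N' _ _ _ _ e he ⟨P, i1, i2, f, hP, hf, hk⟩
    letI : Module R P := Module.compHom P σ
    have hsm : ∀ (r : R) (x : P), r • x = σ r • x := fun _ _ => rfl
    let f' : P →ₗ[R] N' :=
      { toFun := fun x => e (f x)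
        map_add' := fun x y => by simp
        map_smul' := fun r x => by simp [hsm, he] }
    refine ⟨P, i1, inferInstance, f', proj_restrict σ τ h1 h2 (AddEquiv.refl P)
      (fun r x => rfl) hP, e.surjective.comp hf, ?_⟩
    have hiff : ∀ x, x ∈ LinearMap.ker f ↔ x ∈ LinearMap.ker f' := fun x => by
      simp [f']
    exact ih (LinearMap.ker f) (LinearMap.ker f')
      { toFun := fun x => ⟨x.1, (hiff _).1 x.2⟩
        invFun := fun x => ⟨x.1, (hiff _).2 x.2⟩
        left_inv := fun _ => rfl
        right_inv := fun _ => rfl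
        map_add' := fun _ _ => rfl } (fun r x => rfl) hk

theorem proj_comp (h1 : ∀ s, σ (τ s) = s)
    {M N : Type*} [AddCommGroup M] [Module R M] [AddCommGroup N] [Module S N]
    (π : M →+ N) (hs : Function.Surjective π) (hπ : ∀ r m, π (r • m) = σ r • π m)
    (hk : ∀ m, π m = 0 → τ 1 • m = 0) (hM : Module.Projective R M) : Module.Projective S N := by
  obtain ⟨s, hs'⟩ := Module.projective_def'.1 hM
  have hσ : Function.Surjective σ := fun s => ⟨τ s, h1 s⟩
  let g : M →+ (M →₀ S) :=
    { toFun := fun m => (s m).mapRange σ (map_zero σ)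
      map_zero' := by ext; simp
      map_add' := fun x y => by ext; simp }
  have hg : ∀ r m, g (r • m) = σ r • g m := fun r m => by ext; simp [g]
  have hg0 : ∀ m, π m = 0 → g m = 0 := fun m hm => by
    have := hg (τ 1) m
    rw [hk m hm, h1, one_smul, map_zero] at this
    exact this.symm
  have hgg : ∀ a b, π a = π b → g a = g b := fun a b hab => by
    rw [← sub_eq_zero, ← map_sub]
    exact hg0 _ (by rw [map_sub, hab, sub_self])
  have hl := Function.surjInv_eq hs
  let i : N →ₗ[S] (M →₀ S) :=
    { toFun := fun x => g (Function.surjInv hs x)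
      map_add' := fun x y => by
        rw [← map_add]; apply hgg; simp [hl]
      map_smul' := fun r x => by
        obtain ⟨r, rfl⟩ := hσ r
        rw [RingHom.id_apply, ← hg]; apply hgg; rw [hπ, hl, hl] }
  refine Module.Projective.of_split i (Finsupp.linearCombination S π) ?_
  ext x
  obtain ⟨m, rfl⟩ := hs x
  have hm : i (π m) = g m := hgg _ _ (hl _)
  have h := LinearMap.congr_fun hs' m
  simp only [LinearMap.comp_apply, LinearMap.id_apply] at h ⊢
  rw [hm]
  change Finsupp.linearCombination S π ((s m).mapRange σ (map_zero σ)) = _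
  rw [Finsupp.linearCombination_apply, Finsupp.sum_mapRange_index (by simp)]
  conv_rhs => rw [← h]
  rw [Finsupp.linearCombination_apply, Finsupp.sum, Finsupp.sum, map_sum]
  refine Finset.sum_congr rfl fun n _ => ?_
  rw [hπ]; rfl

/-- The component of a module cut out by the idempotent `τ 1`. -/
def CompMod (P : Type*) [AddCommGroup P] [Module R P] : AddSubgroup P where
  carrier := {p | τ 1 • p = p}
  zero_mem' := by simp
  add_mem' := by intro a b ha hb; simp_all
  neg_mem' := by intro a ha; simp_all

theorem compMod_smul_mem (P : Type*) [AddCommGroup P] [Module R P] (s : S) (p : P) :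
    τ s • p ∈ CompMod τ P := by
  change τ 1 • τ s • p = τ s • p
  rw [smul_smul, ← map_mul, one_mul]

/-- The `S`-module structure on the component. -/
@[reducible]
def compModModule (P : Type*) [AddCommGroup P] [Module R P] : Module S (CompMod τ P) where
  smul s p := ⟨τ s • p.1, compMod_smul_mem τ P s p.1⟩
  one_smul p := Subtype.ext p.2
  mul_smul a b p := Subtype.ext (by
    change τ (a * b) • p.1 = τ a • τ b • p.1
    rw [map_mul, mul_smul])
  smul_zero a := Subtype.ext (smul_zero (τ a))
  smul_add a p q := Subtype.ext (smul_add (τ a) p.1 q.1)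
  add_smul a b p := Subtype.ext (by
    change τ (a + b) • p.1 = τ a • p.1 + τ b • p.1
    rw [map_add, add_smul])
  zero_smul p := Subtype.ext (by
    change τ 0 • p.1 = 0
    rw [map_zero, zero_smul])

theorem pdLE_comp (h1 : ∀ s, σ (τ s) = s) (h2 : ∀ r, τ (σ r) = τ 1 * r) (n : ℕ) :
    ∀ (M N : Type u) [AddCommGroup M] [Module R M] [AddCommGroup N] [Module S N]
    (π : M →+ N) (_ : Function.Surjective π) (_ : ∀ r m, π (r • m) = σ r • π m)
    (_ : ∀ m, π m = 0 → τ 1 • m = 0), pdLE R n M → pdLE S n N := by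
  induction n with
  | zero =>
    intro M N _ _ _ _ π hs hπ hk h
    exact proj_comp σ τ h1 π hs hπ hk h
  | succ n ih =>
    rintro M N _ _ _ _ π hs hπ hk ⟨P, i1, i2, f, hP, hf, hker⟩
    letI : Module S (CompMod τ P) := compModModule τ P
    have hsm : ∀ (s : S) (x : CompMod τ P), (s • x).1 = τ s • x.1 := fun _ _ => rfl
    have hπe : ∀ m, π (τ 1 • m) = π m := fun m => by rw [hπ, h1, one_smul]
    have hmem : ∀ x : CompMod τ P, τ 1 • x.1 = x.1 := fun x => x.2
    have hcomm : ∀ (r : R) (p : P), τ 1 • r • p = τ (σ r) • τ 1 • p := fun r p => by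
      rw [h2, smul_smul, smul_smul, mul_right_comm, ← map_mul, one_mul]
    let q : P →+ CompMod τ P :=
      { toFun := fun p => ⟨τ 1 • p, compMod_smul_mem τ P 1 p⟩
        map_zero' := Subtype.ext (smul_zero _)
        map_add' := fun a b => Subtype.ext (smul_add _ a b) }
    have hq : ∀ p, (q p).1 = τ 1 • p := fun _ => rfl
    have hqs : ∀ x : CompMod τ P, q x.1 = x := fun x => Subtype.ext (hmem x)
    have hqsm : ∀ r p, q (r • p) = σ r • q p := fun r p => Subtype.ext (hcomm r p)
    let f' : CompMod τ P →ₗ[S] N :=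
      { toFun := fun x => π (f x.1)
        map_add' := fun x y => by simp
        map_smul' := fun s x => by simp [hsm, hπ, h1] }
    have hf' : ∀ x, f' x = π (f x.1) := fun _ => rfl
    refine ⟨CompMod τ P, inferInstance, inferInstance, f',
      proj_comp σ τ h1 q (fun x => ⟨x.1, hqs x⟩) hqsm
        (fun m hm => by rw [← hq, hm]; rfl) hP, ?_, ?_⟩
    · intro y
      obtain ⟨m, rfl⟩ := hs y
      obtain ⟨p, rfl⟩ := hf m
      exact ⟨q p, by rw [hf', hq, map_smul, hπe]⟩
    · let π' : LinearMap.ker f →+ LinearMap.ker f' :=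
        { toFun := fun p => ⟨q p.1, by
            rw [LinearMap.mem_ker, hf', hq, map_smul, hπe, LinearMap.mem_ker.1 p.2, map_zero]⟩
          map_zero' := Subtype.ext (map_zero q)
          map_add' := fun a b => Subtype.ext (map_add q a.1 b.1) }
      refine ih (LinearMap.ker f) (LinearMap.ker f') π' ?_ ?_ ?_ hker
      · rintro ⟨x, hx⟩
        refine ⟨⟨x.1, ?_⟩, Subtype.ext (hqs x)⟩
        have := hk _ hx
        rwa [← map_smul, hmem] at this
      · intro r p
        exact Subtype.ext (hqsm r p.1)
      · intro p hp
        have h := congrArg (fun z => z.1.1) hp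
        exact Subtype.ext h

end

/-- `pd_{R₁×R₂}(E₁×E₂) = sup{pd_{R₁}(E₁), pd_{R₂}(E₂)}`, where `E₁ × E₂`
carries the componentwise `R₁ × R₂`-module structure. -/
theorem projDim_prod (R₁ R₂ : Type*) [CommRing R₁] [CommRing R₂]
    (E₁ E₂ : Type u) [AddCommGroup E₁] [AddCommGroup E₂]
    [Module R₁ E₁] [Module R₂ E₂] :
    letI : Module (R₁ × R₂) E₁ := Module.compHom E₁ (RingHom.fst R₁ R₂)
    letI : Module (R₁ × R₂) E₂ := Module.compHom E₂ (RingHom.snd R₁ R₂)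
    projDim (R₁ × R₂) (E₁ × E₂) = max (projDim R₁ E₁) (projDim R₂ E₂) := by
  letI m1 : Module (R₁ × R₂) E₁ := Module.compHom E₁ (RingHom.fst R₁ R₂)
  letI m2 : Module (R₁ × R₂) E₂ := Module.compHom E₂ (RingHom.snd R₁ R₂)
  change projDim (R₁ × R₂) (E₁ × E₂) = max (projDim R₁ E₁) (projDim R₂ E₂)
  let τ₁ : R₁ →ₙ+* R₁ × R₂ :=
    { toFun := fun r => (r, 0), map_zero' := rfl, map_add' := by simp, map_mul' := by simp }
  let τ₂ : R₂ →ₙ+* R₁ × R₂ :=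
    { toFun := fun r => (0, r), map_zero' := rfl, map_add' := by simp, map_mul' := by simp }
  have t1 : ∀ r, τ₁ r = (r, 0) := fun _ => rfl
  have t2 : ∀ r, τ₂ r = (0, r) := fun _ => rfl
  have a1 : ∀ s, RingHom.fst R₁ R₂ (τ₁ s) = s := fun _ => rfl
  have a2 : ∀ r, τ₁ (RingHom.fst R₁ R₂ r) = τ₁ 1 * r := fun r => by
    ext <;> simp [t1]
  have b1 : ∀ s, RingHom.snd R₁ R₂ (τ₂ s) = s := fun _ => rfl
  have b2 : ∀ r, τ₂ (RingHom.snd R₁ R₂ r) = τ₂ 1 * r := fun r => by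
    ext <;> simp [t2]
  have s1 : ∀ (r : R₁ × R₂) (x : E₁), r • x = r.1 • x := fun _ _ => rfl
  have s2 : ∀ (r : R₁ × R₂) (x : E₂), r • x = r.2 • x := fun _ _ => rfl
  have main : ∀ n : ℕ, projDim (R₁ × R₂) (E₁ × E₂) ≤ n ↔
      max (projDim R₁ E₁) (projDim R₂ E₂) ≤ n := by
    intro n
    rw [max_le_iff, projDim_le_iff, projDim_le_iff, projDim_le_iff]
    constructor
    · intro h
      constructor
      · refine pdLE_comp (RingHom.fst R₁ R₂) τ₁ a1 a2 n (E₁ × E₂) E₁ (AddMonoidHom.fst E₁ E₂)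
          Prod.fst_surjective (fun r m => rfl) ?_ h
        rintro ⟨x, y⟩ hx
        have hx : x = 0 := hx
        ext <;> simp [s1, s2, t1, hx]
      · refine pdLE_comp (RingHom.snd R₁ R₂) τ₂ b1 b2 n (E₁ × E₂) E₂ (AddMonoidHom.snd E₁ E₂)
          Prod.snd_surjective (fun r m => rfl) ?_ h
        rintro ⟨x, y⟩ hx
        have hx : y = 0 := hx
        ext <;> simp [s1, s2, t2, hx]
    · rintro ⟨h, h'⟩
      exact pdLE_prod (R₁ × R₂) n E₁ E₂ (E₁ × E₂) (LinearEquiv.refl _ _)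
        (pdLE_restrict (RingHom.fst R₁ R₂) τ₁ a1 a2 n E₁ E₁ (AddEquiv.refl _) (fun _ _ => rfl) h)
        (pdLE_restrict (RingHom.snd R₁ R₂) τ₂ b1 b2 n E₂ E₂ (AddEquiv.refl _) (fun _ _ => rfl) h')
  apply le_antisymm
  · generalize max (projDim R₁ E₁) (projDim R₂ E₂) = b at main
    induction b with
    | top => exact le_top
    | coe b => exact (main b).2 le_rfl
  · generalize projDim (R₁ × R₂) (E₁ × E₂) = b at main
    induction b with
    | top => exact le_top
    | coe b => exact (main b).1 le_rfl
end

section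
/- For commutative rings R₁, R₂ and modules Eᵢ over Rᵢ (i = 1,2), the flat dimension of E₁ × E₂ over R₁ × R₂ equals the supremum of the flat dimensions of E₁ over R₁ and of E₂ over R₂. -/
universe u v

/-- `fdLE R n M` means the flat dimension of `M` over `R` is at most `n`. -/
def fdLE (R : Type v) [CommRing R] : ℕ → ∀ (M : Type u) [AddCommGroup M] [Module R M], Prop
  | 0 => fun M _ _ => Module.Flat R M
  | n + 1 => fun M _ _ =>
      ∃ (P : Type u) (_ : AddCommGroup P) (_ : Module R P) (f : P →ₗ[R] M),
        Module.Flat R P ∧ Function.Surjective f ∧ fdLE R n (LinearMap.ker f)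

/-- The flat dimension of `M` over `R`, as an element of `ℕ∞`. -/
noncomputable def flatDim (R : Type v) [CommRing R] (M : Type u) [AddCommGroup M]
    [Module R M] : ℕ∞ :=
  sInf {n : ℕ∞ | ∃ m : ℕ, n = m ∧ fdLE R m M}

universe w

theorem fdLE_of_equiv {R : Type v} [CommRing R] {n : ℕ} {M N : Type u} [AddCommGroup M]
    [Module R M] [AddCommGroup N] [Module R N] (e : M ≃ₗ[R] N) (h : fdLE R n M) :
    fdLE R n N := by
  induction n generalizing M N with
  | zero =>
    have : Module.Flat R M := h
    exact Module.Flat.of_linearEquiv e.symm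
  | succ n ih =>
    obtain ⟨P, _, _, f, hP, hf, hk⟩ := h
    refine ⟨P, _, _, e.toLinearMap ∘ₗ f, hP, e.surjective.comp hf, ?_⟩
    exact ih (LinearEquiv.ofEq _ _ (by ext x; simp)) hk

theorem fdLE_succ {R : Type v} [CommRing R] {n : ℕ} {M : Type u} [AddCommGroup M]
    [Module R M] (h : fdLE R n M) : fdLE R (n + 1) M := by
  induction n generalizing M with
  | zero =>
    refine ⟨M, _, _, LinearMap.id, h, Function.surjective_id, ?_⟩
    have : Subsingleton (LinearMap.ker (LinearMap.id : M →ₗ[R] M)) := by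
      rw [LinearMap.ker_id]; infer_instance
    change Module.Flat R _
    infer_instance
  | succ n ih =>
    obtain ⟨P, _, _, f, hP, hf, hk⟩ := h
    exact ⟨P, _, _, f, hP, hf, ih hk⟩

theorem fdLE_mono {R : Type v} [CommRing R] {n m : ℕ} (hnm : n ≤ m) {M : Type u}
    [AddCommGroup M] [Module R M] (h : fdLE R n M) : fdLE R m M := by
  induction hnm with
  | refl => exact h
  | step _ ih => exact fdLE_succ ih

theorem flat_prod_aux {R : Type v} [CommRing R] {M N : Type u} [AddCommGroup M]
    [Module R M] [AddCommGroup N] [Module R N] (hM : Module.Flat R M) (hN : Module.Flat R N) :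
    Module.Flat R (M × N) := by
  rw [Module.Flat.iff_lTensor_preserves_injective_linearMap]
  intro A B _ _ _ _ f hf
  rw [injective_iff_map_eq_zero]
  intro x hx
  have h1 : (LinearMap.fst R M N).rTensor A x = 0 := by
    apply Module.Flat.lTensor_preserves_injective_linearMap (M := M) f hf
    rw [map_zero, ← LinearMap.comp_apply, LinearMap.lTensor_comp_rTensor,
      ← LinearMap.rTensor_comp_lTensor, LinearMap.comp_apply, hx, map_zero]
  have h2 : (LinearMap.snd R M N).rTensor A x = 0 := by
    apply Module.Flat.lTensor_preserves_injective_linearMap (M := N) f hf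
    rw [map_zero, ← LinearMap.comp_apply, LinearMap.lTensor_comp_rTensor,
      ← LinearMap.rTensor_comp_lTensor, LinearMap.comp_apply, hx, map_zero]
  have h3 : (LinearMap.inl R M N ∘ₗ LinearMap.fst R M N
      + LinearMap.inr R M N ∘ₗ LinearMap.snd R M N) = LinearMap.id := by
    ext <;> simp
  have h4 := congrArg (fun g => LinearMap.rTensor A g x) h3
  simpa [LinearMap.rTensor_add, LinearMap.rTensor_comp, h1, h2] using h4.symm

theorem fdLE_prod {R : Type v} [CommRing R] {n : ℕ} {M N : Type u} [AddCommGroup M]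
    [Module R M] [AddCommGroup N] [Module R N] (hM : fdLE R n M) (hN : fdLE R n N) :
    fdLE R n (M × N) := by
  induction n generalizing M N with
  | zero => exact flat_prod_aux hM hN
  | succ n ih =>
    obtain ⟨P, _, _, f, hP, hf, hk⟩ := hM
    obtain ⟨Q, _, _, g, hQ, hg, hl⟩ := hN
    refine ⟨P × Q, _, _, f.prodMap g, flat_prod_aux hP hQ, hf.prodMap hg, ?_⟩
    refine fdLE_of_equiv ?_ (ih hk hl)
    exact
      { toFun := fun x => ⟨(x.1.1, x.2.1), Prod.ext x.1.2 x.2.2⟩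
        invFun := fun x => (⟨x.1.1, congrArg Prod.fst x.2⟩, ⟨x.1.2, congrArg Prod.snd x.2⟩)
        map_add' := fun _ _ => rfl
        map_smul' := fun _ _ => rfl
        left_inv := fun _ => rfl
        right_inv := fun _ => rfl }

section
variable {S : Type v} {A : Type w} [CommRing S] [CommRing A] [Algebra S A] {e : S}

theorem flat_iff_aux (he : IsIdempotentElem e)
    (H : ∀ x y, algebraMap S A x = algebraMap S A y ↔ e * x = e * y)
    (H' : Function.Surjective (algebraMap S A))
    (N : Type u) [AddCommGroup N] [Module S N] [Module A N] [IsScalarTower S A N] :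
    Module.Flat A N ↔ Module.Flat S N :=
  have := IsLocalization.away_of_isIdempotentElem_of_mul he H H'
  Module.flat_iff_of_isLocalization A (Submonoid.powers e) N

theorem fdLE_restrict (he : IsIdempotentElem e)
    (H : ∀ x y, algebraMap S A x = algebraMap S A y ↔ e * x = e * y)
    (H' : Function.Surjective (algebraMap S A)) {n : ℕ}
    {N : Type u} [AddCommGroup N] [Module S N] [Module A N] [IsScalarTower S A N]
    (h : fdLE A n N) : fdLE S n N := by
  induction n generalizing N with
  | zero => exact (flat_iff_aux he H H' N).1 h
  | succ n ih =>
    obtain ⟨P, _, _, f, hP, hf, hk⟩ := h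
    letI : Module S P := Module.compHom P (algebraMap S A)
    haveI : IsScalarTower S A P := IsScalarTower.of_algebraMap_smul fun _ _ => rfl
    refine ⟨P, _, inferInstance, f.restrictScalars S, (flat_iff_aux he H H' P).1 hP, hf, ?_⟩
    exact fdLE_of_equiv (M := LinearMap.ker f)
      { toFun := fun x => ⟨x.1, x.2⟩
        invFun := fun x => ⟨x.1, x.2⟩
        map_add' := fun _ _ => rfl
        map_smul' := fun _ _ => rfl
        left_inv := fun _ => rfl
        right_inv := fun _ => rfl } (ih hk)

theorem fdLE_component (he : IsIdempotentElem e)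
    (H : ∀ x y, algebraMap S A x = algebraMap S A y ↔ e * x = e * y)
    (H' : Function.Surjective (algebraMap S A)) {n : ℕ}
    {M : Type u} [AddCommGroup M] [Module S M]
    {N : Type u} [AddCommGroup N] [Module S N] [Module A N] [IsScalarTower S A N]
    (g : M →ₗ[S] N) (i : N →ₗ[S] M) (hgi : ∀ x, g (i x) = x) (hig : ∀ x, i (g x) = e • x)
    (h : fdLE S n M) : fdLE A n N := by
  have he1 : algebraMap S A e = 1 := by
    rw [← map_one (algebraMap S A), H, mul_one, he]
  induction n generalizing M N with
  | zero =>
    have : Module.Flat S M := h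
    exact (flat_iff_aux he H H' N).2 (Module.Flat.of_retract i g (LinearMap.ext hgi))
  | succ n ih =>
    obtain ⟨P, _, _, f, hP, hf, hk⟩ := h
    let Q : Submodule S P := LinearMap.ker (LinearMap.lsmul S P (1 - e))
    have hQ : ∀ p : P, p ∈ Q ↔ e • p = p := fun p => by
      simp [Q, sub_eq_zero, eq_comm]
    have hQe : ∀ p : P, e • p ∈ Q := fun p => by rw [hQ, smul_smul, he]
    let σ := Function.surjInv H'
    have hσ : ∀ a, algebraMap S A (σ a) = a := Function.surjInv_eq H'
    letI : SMul A Q := ⟨fun a q => σ a • q⟩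
    have hsm : ∀ (c : S) (x : Q), algebraMap S A c • x = c • x := by
      intro c x
      change σ (algebraMap S A c) • x = c • x
      have h1 := (H _ _).1 (hσ (algebraMap S A c))
      have hx : e • x = x := Subtype.ext ((hQ x.1).1 x.2)
      rw [← hx, smul_smul, smul_smul, mul_comm, h1, mul_comm]
    letI : Module A Q := Function.Surjective.moduleLeft (algebraMap S A) H' hsm
    haveI : IsScalarTower S A Q := IsScalarTower.of_algebraMap_smul hsm
    have hQflat : Module.Flat S Q := 
      Module.Flat.of_retract Q.subtype ((LinearMap.lsmul S P e).codRestrict Q hQe)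
        (LinearMap.ext fun x => Subtype.ext ((hQ x.1).1 x.2))
    let f' : Q →ₗ[S] N := g ∘ₗ f ∘ₗ Q.subtype
    let F : Q →ₗ[A] N := LinearMap.extendScalarsOfSurjective H' f'
    have hF : ∀ x : Q, F x = g (f x.1) := fun _ => rfl
    refine ⟨Q, _, inferInstance, F, (flat_iff_aux he H H' Q).2 hQflat, ?_, ?_⟩
    · intro y
      obtain ⟨p, hp⟩ := hf (i y)
      refine ⟨⟨e • p, hQe p⟩, ?_⟩
      rw [hF, map_smul, map_smul, hp, hgi, ← algebraMap_smul A e y, he1, one_smul]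
    · refine ih (M := LinearMap.ker f) 
        { toFun := fun x => ⟨⟨e • x.1, hQe _⟩, ?_⟩
          map_add' := ?_
          map_smul' := ?_ }
        { toFun := fun x => ⟨x.1.1, ?_⟩
          map_add' := fun _ _ => rfl
          map_smul' := fun _ _ => rfl } ?_ ?_ hk
      · have := x.2
        rw [LinearMap.mem_ker] at this ⊢
        rw [hF, map_smul, this, smul_zero, map_zero]
      · intro x y
        exact Subtype.ext (Subtype.ext (smul_add _ _ _))
      · intro c x
        exact Subtype.ext (Subtype.ext (smul_comm _ _ _))
      · have h0 := x.2
        rw [LinearMap.mem_ker, hF] at h0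
        rw [LinearMap.mem_ker, ← (hQ x.1.1).1 x.1.2, map_smul, ← hig, h0, map_zero]
      · intro x
        exact Subtype.ext (Subtype.ext ((hQ x.1.1).1 x.1.2))
      · intro x
        rfl
end

/-- `fd_{R₁×R₂}(E₁×E₂) = sup{fd_{R₁}(E₁), fd_{R₂}(E₂)}`, where `E₁ × E₂`
carries the componentwise `R₁ × R₂`-module structure. -/
theorem flatDim_prod (R₁ R₂ : Type*) [CommRing R₁] [CommRing R₂]
    (E₁ E₂ : Type u) [AddCommGroup E₁] [AddCommGroup E₂]
    [Module R₁ E₁] [Module R₂ E₂] :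
    letI : Module (R₁ × R₂) E₁ := Module.compHom E₁ (RingHom.fst R₁ R₂)
    letI : Module (R₁ × R₂) E₂ := Module.compHom E₂ (RingHom.snd R₁ R₂)
    flatDim (R₁ × R₂) (E₁ × E₂) = max (flatDim R₁ E₁) (flatDim R₂ E₂) := by
  letI : Module (R₁ × R₂) E₁ := Module.compHom E₁ (RingHom.fst R₁ R₂)
  letI : Module (R₁ × R₂) E₂ := Module.compHom E₂ (RingHom.snd R₁ R₂)
  change flatDim (R₁ × R₂) (E₁ × E₂) = max (flatDim R₁ E₁) (flatDim R₂ E₂)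
  letI : Algebra (R₁ × R₂) R₁ := (RingHom.fst R₁ R₂).toAlgebra
  letI : Algebra (R₁ × R₂) R₂ := (RingHom.snd R₁ R₂).toAlgebra
  haveI : IsScalarTower (R₁ × R₂) R₁ E₁ := IsScalarTower.of_algebraMap_smul fun _ _ => rfl
  haveI : IsScalarTower (R₁ × R₂) R₂ E₂ := IsScalarTower.of_algebraMap_smul fun _ _ => rfl
  have he₁ : IsIdempotentElem ((1, 0) : R₁ × R₂) := by simp [IsIdempotentElem]
  have he₂ : IsIdempotentElem ((0, 1) : R₁ × R₂) := by simp [IsIdempotentElem]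
  have H₁ : ∀ x y, algebraMap (R₁ × R₂) R₁ x = algebraMap (R₁ × R₂) R₁ y ↔
      ((1, 0) : R₁ × R₂) * x = (1, 0) * y := fun x y => by
    simp [RingHom.algebraMap_toAlgebra, Prod.ext_iff]
  have H₂ : ∀ x y, algebraMap (R₁ × R₂) R₂ x = algebraMap (R₁ × R₂) R₂ y ↔
      ((0, 1) : R₁ × R₂) * x = (0, 1) * y := fun x y => by
    simp [RingHom.algebraMap_toAlgebra, Prod.ext_iff]
  have S₁ : Function.Surjective (algebraMap (R₁ × R₂) R₁) := fun x => ⟨(x, 0), rfl⟩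
  have S₂ : Function.Surjective (algebraMap (R₁ × R₂) R₂) := fun x => ⟨(0, x), rfl⟩
  have key : ∀ n, fdLE (R₁ × R₂) n (E₁ × E₂) ↔ fdLE R₁ n E₁ ∧ fdLE R₂ n E₂ := by
    intro n
    refine ⟨fun h => ⟨?_, ?_⟩, fun h => ?_⟩
    · refine fdLE_component he₁ H₁ S₁ (LinearMap.fst (R₁ × R₂) E₁ E₂)
        (LinearMap.inl (R₁ × R₂) E₁ E₂) (fun _ => rfl) (fun x => ?_) h
      exact Prod.ext (one_smul R₁ x.1).symm (zero_smul R₂ x.2).symm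
    · refine fdLE_component he₂ H₂ S₂ (LinearMap.snd (R₁ × R₂) E₁ E₂)
        (LinearMap.inr (R₁ × R₂) E₁ E₂) (fun _ => rfl) (fun x => ?_) h
      exact Prod.ext (zero_smul R₁ x.1).symm (one_smul R₂ x.2).symm
    · exact fdLE_prod (fdLE_restrict he₁ H₁ S₁ h.1) (fdLE_restrict he₂ H₂ S₂ h.2)
  apply le_antisymm
  · rcases Set.eq_empty_or_nonempty {n : ℕ∞ | ∃ m : ℕ, n = m ∧ fdLE R₁ m E₁} with h1 | h1
    · simp [flatDim, h1]
    rcases Set.eq_empty_or_nonempty {n : ℕ∞ | ∃ m : ℕ, n = m ∧ fdLE R₂ m E₂} with h2 | h2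
    · simp [flatDim, h2]
    obtain ⟨a, ha, ha'⟩ := csInf_mem h1
    obtain ⟨b, hb, hb'⟩ := csInf_mem h2
    unfold flatDim
    rw [ha, hb]
    refine sInf_le ⟨max a b, (Nat.mono_cast.map_max (a := a) (b := b)).symm, (key _).2 ⟨?_, ?_⟩⟩
    · exact fdLE_mono (le_max_left _ _) ha'
    · exact fdLE_mono (le_max_right _ _) hb'
  · refine le_sInf ?_
    rintro _ ⟨m, rfl, hm⟩
    exact max_le (sInf_le ⟨m, rfl, ((key m).1 hm).1⟩) (sInf_le ⟨m, rfl, ((key m).1 hm).2⟩)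
end

section
/- A commutative ring R is perfect if and only if the amalgamated duplication R ⋈ I is perfect, for any proper ideal I of R. -/
/-- The amalgamated duplication of a ring `R` along an ideal `I`, as a subring of `R × R`. -/
def dup (R : Type*) [CommRing R] (I : Ideal R) : Subring (R × R) where
  carrier := {x | x.2 - x.1 ∈ I}
  zero_mem' := by simp
  one_mem' := by simp
  add_mem' := by
    intro a b ha hb
    show a.2 + b.2 - (a.1 + b.1) ∈ I
    have h : a.2 + b.2 - (a.1 + b.1) = (a.2 - a.1) + (b.2 - b.1) := by ring
    rw [h]; exact I.add_mem ha hb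
  neg_mem' := by
    intro a ha
    show -a.2 - -a.1 ∈ I
    have h : -a.2 - -a.1 = -(a.2 - a.1) := by ring
    rw [h]; exact I.neg_mem ha
  mul_mem' := by
    intro a b ha hb
    show a.2 * b.2 - a.1 * b.1 ∈ I
    have h : a.2 * b.2 - a.1 * b.1 = a.2 * (b.2 - b.1) + b.1 * (a.2 - a.1) := by ring
    rw [h]; exact I.add_mem (I.mul_mem_left _ hb) (I.mul_mem_left _ ha)

/-- The diagonal embedding `R → R ⋈ I`. -/
def diag (R : Type*) [CommRing R] (I : Ideal R) : R →+* dup R I where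
  toFun r := ⟨(r, r), show r - r ∈ I by simp⟩
  map_one' := rfl
  map_mul' _ _ := rfl
  map_zero' := rfl
  map_add' _ _ := rfl

universe u

/-- A commutative ring is *perfect* if every flat module over it is projective. -/
def IsPerfectRing (R : Type u) [CommRing R] : Prop :=
  ∀ (M : Type u) [AddCommGroup M] [Module R M], Module.Flat R M → Module.Projective R M

theorem IsPerfectRing.of_retract {A B : Type u} [CommRing A] [CommRing B] (f : A →+* B)
    (g : B →+* A) (hgf : ∀ a, g (f a) = a) (hB : IsPerfectRing B) : IsPerfectRing A := by
  intro M _ _ hM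
  let : Algebra A B := f.toAlgebra
  let : Algebra B A := g.toAlgebra
  have : IsScalarTower A B A := IsScalarTower.of_algebraMap_eq (fun a => (hgf a).symm)
  have : Module.Projective B (TensorProduct A B M) := hB _ inferInstance
  have : Module.Projective A (TensorProduct B A (TensorProduct A B M)) := inferInstance
  exact Module.Projective.of_equiv
    ((TensorProduct.AlgebraTensorModule.cancelBaseChange A B A A M).trans (TensorProduct.lid A M))

theorem projective_quot {S : Type u} [CommRing S] (J : Ideal S) (hJ : IsPerfectRing (S ⧸ J))
    (M : Type u) [AddCommGroup M] [Module S M] [Module.Flat S M] :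
    Module.Projective (S ⧸ J) (M ⧸ (J • ⊤ : Submodule S M)) := by
  have : Module.Projective (S ⧸ J) (TensorProduct S (S ⧸ J) M) := hJ _ inferInstance
  exact Module.Projective.of_equiv
    (LinearEquiv.extendScalarsOfSurjective (R := S) (S := S ⧸ J) Ideal.Quotient.mk_surjective
      (TensorProduct.quotTensorEquivQuotSMul M J))

theorem exists_sum_of_mem_smul_top {S F : Type*} [CommRing S] [AddCommGroup F] [Module S F]
    (J : Ideal S) (x : F) (hx : x ∈ (J • ⊤ : Submodule S F)) :
    ∃ (n : ℕ) (j : Fin n → S) (e : Fin n → F), (∀ i, j i ∈ J) ∧ x = ∑ i, j i • e i := by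
  induction hx using Submodule.smul_induction_on' with
  | smul r hr m _ => exact ⟨1, fun _ => r, fun _ => m, fun _ => hr, by simp⟩
  | add x _ y _ hx hy =>
    obtain ⟨n, j, e, h, rfl⟩ := hx
    obtain ⟨n', j', e', h', rfl⟩ := hy
    refine ⟨n + n', Fin.append j j', Fin.append e e', ?_, ?_⟩
    · intro i
      refine Fin.addCases (fun i => ?_) (fun i => ?_) i
      · simpa using h i
      · simpa using h' i
    · simp [Fin.sum_univ_add]

theorem flat_pure {S F M N : Type*} [CommRing S] [AddCommGroup F] [Module S F]
    [AddCommGroup M] [Module S M] [Module.Flat S M] [AddCommGroup N] [Module S N]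
    (J : Ideal S) (p : F →ₗ[S] M) (hp : Function.Surjective p)
    (hN : ∀ j ∈ J, ∀ n : N, j • n = 0) (f : LinearMap.ker p →ₗ[S] N)
    (x : LinearMap.ker p) (hx : (x : F) ∈ (J • ⊤ : Submodule S F)) : f x = 0 := by
  obtain ⟨n, j, e, hj, hxe⟩ := exists_sum_of_mem_smul_top J _ hx
  have h0 : ∑ i, j i • p (e i) = 0 := by
    have := x.2
    rw [LinearMap.mem_ker, hxe] at this
    simpa using this
  obtain ⟨k, a, y, h1, h2⟩ := Module.Flat.isTrivialRelation_of_sum_smul_eq_zero h0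
  choose y' hy' using fun i => hp (y i)
  have hk : ∀ i, e i - ∑ l, a i l • y' l ∈ LinearMap.ker p := by
    intro i
    simp [LinearMap.mem_ker, hy', h1]
  have hx2 : x = ∑ i, j i • (⟨_, hk i⟩ : LinearMap.ker p) := by
    apply Subtype.ext
    rw [hxe]
    have : ∑ i, j i • ∑ l, a i l • y' l = 0 := by
      simp_rw [Finset.smul_sum, smul_smul]
      rw [Finset.sum_comm]
      simp_rw [← Finset.sum_smul, h2]
      simp
    simp [smul_sub, Finset.sum_sub_distrib, this]
  rw [hx2, map_sum]
  exact Finset.sum_eq_zero fun i _ => by rw [map_smul, hN _ (hj i)]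

theorem flat_extend {S : Type u} [CommRing S] {F M N : Type u} [AddCommGroup F] [Module S F]
    [AddCommGroup M] [Module S M] [Module.Flat S M] [AddCommGroup N] [Module S N]
    (J : Ideal S) (hJ : IsPerfectRing (S ⧸ J)) (p : F →ₗ[S] M) (hp : Function.Surjective p)
    (hN : ∀ j ∈ J, ∀ n : N, j • n = 0) (f : LinearMap.ker p →ₗ[S] N) :
    ∃ g : F →ₗ[S] N, ∀ x : LinearMap.ker p, g x = f x := by
  have := projective_quot J hJ M
  let JF : Submodule S F := J • ⊤
  let JM : Submodule S M := J • ⊤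
  have hle : JF ≤ JM.comap p := by
    rw [← Submodule.map_le_iff_le_comap, Submodule.map_smul'']
    exact smul_mono_right _ le_top
  let q : (F ⧸ JF) →ₗ[S] (M ⧸ JM) := JF.mapQ JM p hle
  have hq : Function.Surjective q := by
    intro m
    obtain ⟨m, rfl⟩ := Submodule.Quotient.mk_surjective _ m
    obtain ⟨x, rfl⟩ := hp m
    exact ⟨Submodule.Quotient.mk x, rfl⟩
  let q' : (F ⧸ JF) →ₗ[S ⧸ J] (M ⧸ JM) :=
    LinearMap.extendScalarsOfSurjective Ideal.Quotient.mk_surjective q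
  obtain ⟨s', hs'⟩ := Module.projective_lifting_property q' LinearMap.id hq
  let s : (M ⧸ JM) →ₗ[S] (F ⧸ JF) := s'.restrictScalars S
  have hs : ∀ m, q (s m) = m := fun m => LinearMap.congr_fun hs' m
  let φ : LinearMap.ker p →ₗ[S] LinearMap.ker q :=
    (JF.mkQ.comp (LinearMap.ker p).subtype).codRestrict _ (by
      intro x
      have : p x = 0 := x.2
      simp [q, this])
  have hφ : Function.Surjective φ := by
    rintro ⟨y, hy⟩
    obtain ⟨y, rfl⟩ := Submodule.Quotient.mk_surjective _ y
    have hy' : p y ∈ JM := by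
      rw [LinearMap.mem_ker] at hy
      exact (Submodule.Quotient.mk_eq_zero _).1 hy
    have : p y ∈ JF.map p := by
      rw [Submodule.map_smul'', Submodule.map_top, LinearMap.range_eq_top.2 hp]
      exact hy'
    obtain ⟨z, hz, hzy⟩ := this
    refine ⟨⟨y - z, by simp [hzy]⟩, Subtype.ext ?_⟩
    change (Submodule.Quotient.mk (y - z) : F ⧸ JF) = Submodule.Quotient.mk y
    rw [Submodule.Quotient.eq]
    simpa using hz
  have hker : LinearMap.ker φ ≤ LinearMap.ker f := by
    intro x hx
    refine flat_pure J p hp hN f x ?_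
    have := congrArg Subtype.val (LinearMap.mem_ker.1 hx)
    exact (Submodule.Quotient.mk_eq_zero _).1 this
  let t : LinearMap.ker q →ₗ[S] N :=
    ((LinearMap.ker φ).liftQ f hker).comp (φ.quotKerEquivOfSurjective hφ).symm.toLinearMap
  have ht : ∀ x, t (φ x) = f x := by
    intro x
    have : (φ.quotKerEquivOfSurjective hφ).symm (φ x) = Submodule.Quotient.mk x := by
      rw [LinearEquiv.symm_apply_eq]; rfl
    simp [t, this]
  let ρ : F →ₗ[S] LinearMap.ker q :=
    (JF.mkQ - s.comp (q.comp JF.mkQ)).codRestrict _ (by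
      intro x
      rw [LinearMap.mem_ker]
      simp only [LinearMap.sub_apply, LinearMap.comp_apply, map_sub, hs, sub_self])
  refine ⟨t.comp ρ, fun x => ?_⟩
  rw [← ht, LinearMap.comp_apply]
  congr 1
  apply Subtype.ext
  change JF.mkQ x - s (q (JF.mkQ x)) = JF.mkQ x
  have : q (JF.mkQ x) = 0 := (φ x).2
  rw [this]; simp

theorem projective_of_mul_eq_bot {S : Type u} [CommRing S] (J₁ J₂ : Ideal S)
    (h : ∀ a ∈ J₁, ∀ b ∈ J₂, b * a = 0)
    (h₁ : IsPerfectRing (S ⧸ J₁)) (h₂ : IsPerfectRing (S ⧸ J₂))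
    {F M : Type u} [AddCommGroup F] [Module S F] [Module.Projective S F]
    [AddCommGroup M] [Module S M] [Module.Flat S M]
    (p : F →ₗ[S] M) (hp : Function.Surjective p) : Module.Projective S M := by
  let K : Submodule S F := LinearMap.ker p
  let JK : Submodule S K := J₁ • ⊤
  obtain ⟨g, hg⟩ := flat_extend J₁ h₁ p hp (N := K ⧸ JK) (by
    intro j hj n
    obtain ⟨n, rfl⟩ := Submodule.Quotient.mk_surjective _ n
    rw [← Submodule.Quotient.mk_smul, Submodule.Quotient.mk_eq_zero]
    exact Submodule.smul_mem_smul hj trivial) JK.mkQ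
  obtain ⟨g', hg'⟩ := Module.projective_lifting_property JK.mkQ g JK.mkQ_surjective
  let d : K →ₗ[S] JK := (LinearMap.id - g'.comp K.subtype).codRestrict _ (by
    intro x
    rw [← Submodule.Quotient.mk_eq_zero]
    change JK.mkQ (x - g' x) = 0
    rw [map_sub, ← hg x, ← hg']
    simp)
  obtain ⟨e, he⟩ := flat_extend J₂ h₂ p hp (N := JK) (by
    rintro b hb ⟨n, hn⟩
    apply Subtype.ext
    change b • n = 0
    induction hn using Submodule.smul_induction_on' with
    | smul r hr m _ => rw [smul_smul, h r hr b hb, zero_smul]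
    | add x _ y _ hx hy => rw [smul_add, hx, hy, add_zero]) d
  let r : F →ₗ[S] K := g' + JK.subtype.comp e
  have hr : ∀ x : K, r x = x := by
    intro x
    change g' x + (e x : K) = x
    rw [he]
    change g' x + (x - g' x) = x
    abel
  -- the section of `p`
  let w : F →ₗ[S] F := LinearMap.id - K.subtype.comp r
  have hw : LinearMap.ker p ≤ LinearMap.ker w := by
    intro x hx
    have := hr ⟨x, hx⟩
    simp only [LinearMap.mem_ker, w, LinearMap.sub_apply, LinearMap.comp_apply]
    rw [this]; simp
  let σ : M →ₗ[S] F :=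
    (K.liftQ w hw).comp (p.quotKerEquivOfSurjective hp).symm.toLinearMap
  refine Module.Projective.of_split σ p ?_
  ext m
  obtain ⟨x, rfl⟩ := hp m
  have : (p.quotKerEquivOfSurjective hp).symm (p x) = Submodule.Quotient.mk x := by
    rw [LinearEquiv.symm_apply_eq]; rfl
  have h2 : p (r x : F) = 0 := (r x).2
  simp [σ, this, w, K, h2]

theorem IsPerfectRing.of_mul_eq_bot {S : Type u} [CommRing S] (J₁ J₂ : Ideal S)
    (h : ∀ a ∈ J₁, ∀ b ∈ J₂, b * a = 0)
    (h₁ : IsPerfectRing (S ⧸ J₁)) (h₂ : IsPerfectRing (S ⧸ J₂)) : IsPerfectRing S := by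
  intro M _ _ hM
  exact projective_of_mul_eq_bot J₁ J₂ h h₁ h₂ (Finsupp.linearCombination S (id : M → M))
    (Finsupp.linearCombination_id_surjective S M)

theorem IsPerfectRing.quot_ker {R S : Type u} [CommRing R] [CommRing S] (hR : IsPerfectRing R)
    (f : S →+* R) (hf : Function.Surjective f) : IsPerfectRing (S ⧸ RingHom.ker f) := by
  let e := RingHom.quotientKerEquivOfSurjective hf
  exact IsPerfectRing.of_retract e.toRingHom e.symm.toRingHom (fun a => e.symm_apply_apply a) hR

/-- `R` is a perfect ring iff `R ⋈ I` is a perfect ring. -/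
theorem isPerfectRing_iff_dup (R : Type u) [CommRing R] (I : Ideal R) (hI : I ≠ ⊤) :
    IsPerfectRing R ↔ IsPerfectRing (dup R I) := by
  let p₁ : dup R I →+* R := (RingHom.fst R R).comp (dup R I).subtype
  let p₂ : dup R I →+* R := (RingHom.snd R R).comp (dup R I).subtype
  constructor
  · intro hR
    refine IsPerfectRing.of_mul_eq_bot (RingHom.ker p₁) (RingHom.ker p₂) ?_
      (hR.quot_ker p₁ fun r => ⟨diag R I r, rfl⟩) (hR.quot_ker p₂ fun r => ⟨diag R I r, rfl⟩)
    intro a ha b hb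
    have ha' : a.1.1 = 0 := ha
    have hb' : b.1.2 = 0 := hb
    apply Subtype.ext
    apply Prod.ext
    · change b.1.1 * a.1.1 = 0
      rw [ha', mul_zero]
    · change b.1.2 * a.1.2 = 0
      rw [hb', zero_mul]
  · exact IsPerfectRing.of_retract (diag R I) p₁ fun _ => rfl
end
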